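/- (Equation (18): the aggregated sum over all h with d_h ≠ 1.) Let k ≥ 1 and n ≥ 2k. Let σ ∈ Equiv.Perm (Fin (2*n)) be the n-cycle with σ(i) = i+1 mod n for i < n and σ(i) = i for i ≥ n, and let P be the subgroup of Equiv.Perm (Fin (2*n)) consisting of all permutations π with π(i) = i for every i < n. Then Σ_{1<h<n, gcd(n,h) ≠ 1} Σ_{π ∈ P} (F k (σ^h * π) − F (k−1) (σ^h * π)) = n! · Σ_{1<h<n, gcd(n,h) ≠ 1, (n/gcd(n,h)) ∣ k} C(gcd(n,h), k·gcd(n,h)/n), where C(a,b) is the binomial coefficient. -/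

import Mathlib

/-- `F k τ` is the number of `k`-element subsets of `Fin m` invariant under `τ`. -/
def F {m : ℕ} (k : ℕ) (τ : Equiv.Perm (Fin m)) : ℕ :=
  ((Finset.univ : Finset (Finset (Fin m))).filter
    (fun s => s.card = k ∧ s.image τ = s)).card

/-- number of invariant `k`-subsets, over any finite type -/
def FF {α : Type} [Fintype α] [DecidableEq α] (k : ℕ) (τ : Equiv.Perm α) : ℕ :=
  ((Finset.univ : Finset (Finset α)).filter
    (fun s => s.card = k ∧ s.image τ = s)).card

lemma F_eq_FF {m : ℕ} (k : ℕ) (τ : Equiv.Perm (Fin m)) : F k τ = FF k τ := rfl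

lemma image_perm_iff {α : Type} [DecidableEq α] (τ : Equiv.Perm α) (s : Finset α) :
    s.image τ = s ↔ ∀ x, τ x ∈ s ↔ x ∈ s := by
  constructor
  · intro h x
    conv_lhs => rw [← h]
    simp
  · intro h
    ext y
    obtain ⟨x, rfl⟩ := τ.surjective y
    simp [h]

lemma FF_conj {α β : Type} [Fintype α] [DecidableEq α] [Fintype β] [DecidableEq β]
    (e : α ≃ β) (k : ℕ) (τ : Equiv.Perm α) : FF k (e.permCongr τ) = FF k τ := by
  symm
  unfold FF
  refine Finset.card_bij' (fun s _ => s.map e.toEmbedding) (fun s _ => s.map e.symm.toEmbedding)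
    ?_ ?_ ?_ ?_
  · intro s hs
    simp only [Finset.mem_filter, Finset.mem_univ, true_and, image_perm_iff, Finset.card_map] at hs ⊢
    refine ⟨hs.1, fun x => ?_⟩
    have := hs.2 (e.symm x)
    simpa [Finset.mem_map_equiv] using this
  · intro s hs
    simp only [Finset.mem_filter, Finset.mem_univ, true_and, image_perm_iff, Finset.card_map] at hs ⊢
    refine ⟨hs.1, fun x => ?_⟩
    have := hs.2 (e x)
    simpa [Finset.mem_map_equiv] using this
  · intro s _
    ext x
    simp [Finset.mem_map_equiv]
  · intro s _
    ext x
    simp [Finset.mem_map_equiv]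

lemma FF_sum {α β : Type} [Fintype α] [DecidableEq α] [Fintype β] [DecidableEq β]
    (k : ℕ) (ρ : Equiv.Perm α) (π : Equiv.Perm β) :
    FF k (Equiv.Perm.sumCongr ρ π) = ∑ i ∈ Finset.range (k + 1), FF i ρ * FF (k - i) π := by
  have key : FF k (Equiv.Perm.sumCongr ρ π) =
      ∑ i ∈ Finset.range (k + 1),
        (((Finset.univ : Finset (Finset α)).filter (fun s => s.card = i ∧ s.image ρ = s)) ×ˢ
        ((Finset.univ : Finset (Finset β)).filter
          (fun s => s.card = k - i ∧ s.image π = s))).card := by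
    rw [← Finset.card_sigma]
    unfold FF
    refine Finset.card_bij' (fun s _ => ⟨s.toLeft.card, (s.toLeft, s.toRight)⟩)
      (fun p _ => p.2.1.disjSum p.2.2) ?_ ?_ ?_ ?_
    · intro s hs
      simp only [Finset.mem_filter, Finset.mem_univ, true_and, image_perm_iff] at hs
      have hc := s.card_toLeft_add_card_toRight
      simp only [Finset.mem_sigma, Finset.mem_range, Finset.mem_product, Finset.mem_filter,
        Finset.mem_univ, true_and, image_perm_iff]
      refine ⟨by omega, fun x => ?_, by omega, fun x => ?_⟩
      · simpa using hs.2 (Sum.inl x)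
      · simpa using hs.2 (Sum.inr x)
    · rintro ⟨i, A, B⟩ hs
      simp only [Finset.mem_sigma, Finset.mem_range, Finset.mem_product, Finset.mem_filter,
        Finset.mem_univ, true_and, image_perm_iff] at hs ⊢
      obtain ⟨h1, ⟨h2, h3⟩, h4, h5⟩ := hs
      refine ⟨by rw [Finset.card_disjSum]; omega, ?_⟩
      rintro (x | x)
      · simpa using h3 x
      · simpa using h5 x
    · intro s _
      ext x
      rcases x with x | x <;> simp
    · rintro ⟨i, A, B⟩ hs
      simp only [Finset.mem_sigma, Finset.mem_range, Finset.mem_product, Finset.mem_filter,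
        Finset.mem_univ, true_and, image_perm_iff] at hs
      obtain ⟨h1, ⟨h2, h3⟩, h4, h5⟩ := hs
      subst h2
      simp
  rw [key]
  simp only [Finset.card_product]
  rfl

open scoped Pointwise in
lemma burnside (n j : ℕ) (hj : j ≤ n) :
    ∑ π : Equiv.Perm (Fin n), FF j π = n.factorial := by
  classical
  have h := MulAction.sum_card_fixedBy_eq_card_orbits_mul_card_group (Equiv.Perm (Fin n))
    (Set.powersetCard (Fin n) j)
  have hp : MulAction.IsPretransitive (Equiv.Perm (Fin n)) (Set.powersetCard (Fin n) j) :=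
    Set.powersetCard.isPretransitive
  have hne : Nonempty (Set.powersetCard (Fin n) j) := by
    obtain ⟨s, hs⟩ := Finset.exists_subset_card_eq (s := (Finset.univ : Finset (Fin n))) (n := j)
      (by simpa using hj)
    exact ⟨⟨s, hs.2⟩⟩
  have h1 : Fintype.card (MulAction.orbitRel.Quotient (Equiv.Perm (Fin n))
      (Set.powersetCard (Fin n) j)) = 1 := by
    rw [Fintype.card_eq_one_iff_nonempty_unique]
    have := (MulAction.pretransitive_iff_subsingleton_quotient (Equiv.Perm (Fin n))
      (Set.powersetCard (Fin n) j)).1 hp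
    obtain ⟨x⟩ := hne
    exact ⟨⟨⟨Quotient.mk'' x⟩, fun _ => Subsingleton.elim _ _⟩⟩
  rw [h1, one_mul, Fintype.card_perm, Fintype.card_fin] at h
  rw [← h]
  refine Finset.sum_congr rfl fun π _ => ?_
  unfold FF
  rw [← Fintype.card_coe]
  refine Fintype.card_congr
    { toFun := fun s => ⟨⟨s.1, ?_⟩, ?_⟩
      invFun := fun s => ⟨s.1.1, ?_⟩
      left_inv := fun _ => rfl
      right_inv := fun _ => rfl }
  · exact (Finset.mem_filter.1 s.2).2.1
  · have := (Finset.mem_filter.1 s.2).2.2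
    rw [MulAction.mem_fixedBy]
    apply Subtype.ext
    rw [Set.powersetCard.coe_smul]
    exact this
  · have := s.2
    rw [MulAction.mem_fixedBy] at this
    have h2 := congrArg Subtype.val this
    rw [Set.powersetCard.coe_smul] at h2
    simp only [Finset.mem_filter, Finset.mem_univ, true_and]
    exact ⟨s.1.2, h2⟩

lemma sum_FF (n k : ℕ) (hk : k ≤ n) (ρ : Equiv.Perm (Fin n)) :
    ∑ π : Equiv.Perm (Fin n), FF k (Equiv.Perm.sumCongr ρ π) =
      n.factorial * ∑ i ∈ Finset.range (k + 1), FF i ρ := by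
  simp only [FF_sum]
  rw [Finset.sum_comm, Finset.mul_sum]
  refine Finset.sum_congr rfl fun i _ => ?_
  rw [← Finset.mul_sum, burnside n (k - i) (by omega), mul_comm]

lemma perm_pow_val {n : ℕ} (ρ : Equiv.Perm (Fin n))
    (c : ℕ) (hρ : ∀ i, ((ρ i : Fin n) : ℕ) = (i + c) % n) (m : ℕ) (i : Fin n) :
    (((ρ ^ m) i : Fin n) : ℕ) = (i + m * c) % n := by
  induction m with
  | zero => simp [Nat.mod_eq_of_lt i.2]
  | succ m ih =>
    rw [pow_succ', Equiv.Perm.mul_apply, hρ, ih, Nat.mod_add_mod]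
    congr 1
    ring

lemma inv_perm_pow {α : Type} (ρ : Equiv.Perm α) (s : Finset α)
    (h : ∀ x, ρ x ∈ s ↔ x ∈ s) (m : ℕ) (x : α) : (ρ ^ m) x ∈ s ↔ x ∈ s := by
  induction m with
  | zero => simp
  | succ m ih => rw [pow_succ', Equiv.Perm.mul_apply, h, ih]

lemma exists_step (n h a b : ℕ) (hn : 0 < n) (hab : a % n.gcd h = b % n.gcd h) (hb : b < n) :
    ∃ m, (a + m * h) % n = b := by
  have h1 : ((n.gcd h : ℕ) : ℤ) ∣ (b : ℤ) - a := (Nat.modEq_iff_dvd).1 hab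
  obtain ⟨c, hc⟩ := h1
  have hbez := Nat.gcd_eq_gcd_ab n h
  have hn' : (n : ℤ) ≠ 0 := by omega
  refine ⟨((c * n.gcdB h) % n).toNat, ?_⟩
  have hm : ((((c * n.gcdB h) % n).toNat : ℕ) : ℤ) = (c * n.gcdB h) % n :=
    Int.toNat_of_nonneg (Int.emod_nonneg _ hn')
  have : (a + ((c * n.gcdB h) % n).toNat * h) ≡ b [MOD n] := by
    rw [Nat.modEq_iff_dvd]
    push_cast
    rw [hm]
    have hd := Int.emod_add_mul_ediv (c * n.gcdB h) n
    refine ⟨c * n.gcdA h + (c * n.gcdB h / n) * h, ?_⟩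
    have e1 : (b : ℤ) = a + (n * n.gcdA h + h * n.gcdB h) * c := by rw [← hbez]; linarith
    have e2 : (c * n.gcdB h) % n = c * n.gcdB h - n * (c * n.gcdB h / n) := by linarith
    rw [e2, e1]
    ring
  rw [this, Nat.mod_eq_of_lt hb]

lemma FF_rot_aux (q d h k : ℕ) (hq : 0 < q) (hd : 0 < d) (hg : (q * d).gcd h = d)
    (ρ : Equiv.Perm (Fin (q * d)))
    (hρ : ∀ i, ((ρ i : Fin (q * d)) : ℕ) = (i + h) % (q * d)) :
    FF k ρ = ((Finset.univ : Finset (Finset (Fin d))).filter (fun T => q * T.card = k)).card := by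
  symm
  unfold FF
  have hdh : d ∣ h := hg ▸ Nat.gcd_dvd_right _ _
  refine Finset.card_bij
    (fun T _ => ((Finset.univ : Finset (Fin q)) ×ˢ T).map finProdFinEquiv.toEmbedding) ?_ ?_ ?_
  · intro T hT
    simp only [Finset.mem_filter, Finset.mem_univ, true_and] at hT ⊢
    rw [image_perm_iff]
    refine ⟨by simp [hT], fun x => ?_⟩
    have : (ρ x).modNat = x.modNat := by
      apply Fin.ext
      simp only [Fin.modNat, hρ]
      rw [Nat.mod_mod_of_dvd _ (Dvd.intro_left q rfl)]
      obtain ⟨c, rfl⟩ := hdh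
      simp
    simp [Finset.mem_map_equiv, finProdFinEquiv_symm_apply, this]
  · intro T _ T' _ hTT
    have := Finset.map_injective _ hTT
    ext t
    have h2 := congrArg (fun s => ((⟨0, hq⟩ : Fin q), t) ∈ s) this
    simpa using h2
  · intro s hs
    simp only [Finset.mem_filter, Finset.mem_univ, true_and, image_perm_iff] at hs
    obtain ⟨hs1, hs2⟩ := hs
    have hmem : ∀ x y : Fin (q * d), x.modNat = y.modNat → (x ∈ s ↔ y ∈ s) := by
      intro x y hxy
      have hxy' : (x : ℕ) % d = (y : ℕ) % d := congrArg Fin.val hxy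
      obtain ⟨m, hm⟩ := exists_step (q * d) h x y (Nat.mul_pos hq hd)
        (by rw [hg]; exact hxy') y.2
      have : (ρ ^ m) x = y := by
        apply Fin.ext
        rw [perm_pow_val ρ h hρ, hm]
      rw [← this, inv_perm_pow ρ s hs2]
    have heq : ((Finset.univ : Finset (Fin q)) ×ˢ (s.image Fin.modNat)).map
        finProdFinEquiv.toEmbedding = s := by
      ext x
      simp only [Finset.mem_map_equiv, finProdFinEquiv_symm_apply, Finset.mem_product,
        Finset.mem_univ, true_and, Finset.mem_image]
      constructor
      · rintro ⟨y, hy, hyx⟩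
        exact (hmem y x hyx).1 hy
      · intro hx
        exact ⟨x, hx, rfl⟩
    refine ⟨s.image Fin.modNat, ?_, heq⟩
    simp only [Finset.mem_filter, Finset.mem_univ, true_and]
    rw [← hs1]
    conv_rhs => rw [← heq]
    simp

lemma FF_rot (n h k : ℕ) (hn : 0 < n) (ρ : Equiv.Perm (Fin n))
    (hρ : ∀ i, ((ρ i : Fin n) : ℕ) = (i + h) % n) :
    FF k ρ = if n / n.gcd h ∣ k then (n.gcd h).choose (k * n.gcd h / n) else 0 := by
  obtain ⟨d, hd⟩ : ∃ d, d = n.gcd h := ⟨_, rfl⟩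
  have hd0 : 0 < d := hd ▸ Nat.gcd_pos_of_pos_left _ hn
  obtain ⟨q, hq⟩ : d ∣ n := hd ▸ Nat.gcd_dvd_left _ _
  rw [mul_comm] at hq
  subst hq
  have hq0 : 0 < q := Nat.pos_of_mul_pos_right hn
  rw [FF_rot_aux q d h k hq0 hd0 hd.symm ρ hρ, ← hd, Nat.mul_div_cancel _ hd0]
  split_ifs with hk
  · obtain ⟨c, rfl⟩ := hk
    have e : q * c * d / (q * d) = c := by
      rw [show q * c * d = c * (q * d) by ring]
      exact Nat.mul_div_cancel _ hn
    rw [e]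
    have : (Finset.univ.filter (fun T : Finset (Fin d) => q * T.card = q * c)) =
        Finset.powersetCard c Finset.univ := by
      ext T
      simp [Finset.mem_powersetCard, hq0.ne']
    rw [this, Finset.card_powersetCard, Finset.card_univ, Fintype.card_fin]
  · rw [Finset.card_eq_zero, Finset.filter_eq_empty_iff]
    intro T _ hT
    exact hk ⟨_, hT.symm⟩

/-- splitting the points into the first `n` and the last `n` -/
def splitE (n : ℕ) : Fin n ⊕ Fin n ≃ Fin (2 * n) :=
  finSumFinEquiv.trans (finCongr (two_mul n).symm)

lemma splitE_inl (n : ℕ) (i : Fin n) : ((splitE n (Sum.inl i) : Fin (2 * n)) : ℕ) = i := by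
  simp [splitE]

lemma splitE_inr (n : ℕ) (i : Fin n) : ((splitE n (Sum.inr i) : Fin (2 * n)) : ℕ) = n + i := by
  simp [splitE, add_comm]

lemma permCongr_mul' {α β : Type} (e : α ≃ β) (a b : Equiv.Perm α) :
    e.permCongr a * e.permCongr b = e.permCongr (a * b) := by
  ext x
  simp

lemma sum_P (n k : ℕ) (ρ : Equiv.Perm (Fin n)) (hk : k ≤ n) :
    ∑ π ∈ (Finset.univ : Finset (Equiv.Perm (Fin (2 * n)))).filter
          (fun π => ∀ i : Fin (2 * n), (i : ℕ) < n → π i = i),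
      F k ((splitE n).permCongr (Equiv.Perm.sumCongr ρ 1) * π) =
      n.factorial * ∑ i ∈ Finset.range (k + 1), FF i ρ := by
  rw [← sum_FF n k hk]
  symm
  refine Finset.sum_bij (fun π _ => (splitE n).permCongr (Equiv.Perm.sumCongr 1 π)) ?_ ?_ ?_ ?_
  · intro π _
    simp only [Finset.mem_filter, Finset.mem_univ, true_and]
    intro i hi
    obtain ⟨x, rfl⟩ := (splitE n).surjective i
    rcases x with x | x
    · simp
    · rw [splitE_inr] at hi
      omega
  · intro π _ π' _ h
    have := (splitE n).permCongr.injective h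
    ext x
    have h2 := congrArg (fun f => f (Sum.inr x)) this
    simp at h2
    rw [h2]
  · intro π hπ
    simp only [Finset.mem_filter, Finset.mem_univ, true_and] at hπ
    have hfix : ∀ x : Fin n, (splitE n).permCongr.symm π (Sum.inl x) = Sum.inl x := by
      intro x
      have := hπ (splitE n (Sum.inl x)) (by rw [splitE_inl]; exact x.2)
      simp [Equiv.permCongr_symm, Equiv.permCongr_apply, this]
    have hr : (splitE n).permCongr.symm π ∈ (Equiv.Perm.sumCongrHom (Fin n) (Fin n)).range := by
      apply Equiv.Perm.mem_sumCongrHom_range_of_perm_mapsTo_inl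
      rintro _ ⟨x, rfl⟩
      exact ⟨x, (hfix x).symm⟩
    obtain ⟨⟨a, b⟩, hab⟩ := hr
    have hab' : Equiv.Perm.sumCongr a b = (splitE n).permCongr.symm π := hab
    have ha : a = 1 := by
      ext x
      have := hfix x
      rw [← hab'] at this
      simp at this
      simp [this]
    subst ha
    refine ⟨b, Finset.mem_univ _, ?_⟩
    rw [hab', Equiv.apply_symm_apply]
  · intro π _
    rw [F_eq_FF, permCongr_mul', FF_conj, Equiv.Perm.sumCongr_mul]
    simp

/-- Equation (18): the aggregated sum over all `h` with `1 < h < n`, `gcd(n,h) ≠ 1`: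
`Σ_h Σ_{π ∈ P} (F k (σ^h π) - F (k-1) (σ^h π))
  = n! ⬝ Σ_{h : (n/d_h) ∣ k} C(d_h, k⬝d_h/n)`. -/
theorem eq18 (n k : ℕ) (hk : 1 ≤ k) (hn : 2 * k ≤ n)
    (σ : Equiv.Perm (Fin (2 * n)))
    (hσ : ∀ i : Fin (2 * n),
      ((σ i : ℕ) = if (i : ℕ) < n then ((i : ℕ) + 1) % n else (i : ℕ))) :
    ∑ h ∈ (Finset.Ico 2 n).filter (fun h => Nat.gcd n h ≠ 1),
      ∑ π ∈ (Finset.univ : Finset (Equiv.Perm (Fin (2 * n)))).filter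
          (fun π => ∀ i : Fin (2 * n), (i : ℕ) < n → π i = i),
        ((F k (σ ^ h * π) : ℤ) - (F (k - 1) (σ ^ h * π) : ℤ))
      = (n.factorial : ℤ) *
        ∑ h ∈ (Finset.Ico 2 n).filter
            (fun h => Nat.gcd n h ≠ 1 ∧ (n / Nat.gcd n h) ∣ k),
          ((Nat.gcd n h).choose (k * Nat.gcd n h / n) : ℤ) := by
  rw [Finset.mul_sum, ← Finset.filter_filter, Finset.sum_filter (fun h => n / Nat.gcd n h ∣ k)]
  refine Finset.sum_congr rfl fun h hh => ?_
  have hn0 : 0 < n := by omega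
  obtain ⟨m, rfl⟩ : ∃ m, n = m + 1 := ⟨n - 1, by omega⟩
  have hrot : ∀ i : Fin (m + 1), ((finRotate (m + 1) i : Fin (m + 1)) : ℕ) = (i + 1) % (m + 1) := by
    intro i
    rw [finRotate_apply, Fin.val_add]
    simp
  have hσe : σ = (splitE (m + 1)).permCongr (Equiv.Perm.sumCongr (finRotate (m + 1)) 1) := by
    ext x
    obtain ⟨y, rfl⟩ := (splitE (m + 1)).surjective x
    rw [hσ, Equiv.permCongr_apply, Equiv.symm_apply_apply]
    rcases y with y | y
    · rw [splitE_inl, if_pos y.2, Equiv.Perm.sumCongr_apply, Sum.map_inl, splitE_inl, hrot]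
    · rw [splitE_inr, if_neg (by omega), Equiv.Perm.sumCongr_apply, Sum.map_inr, splitE_inr]
      rfl
  have hpow : ∀ j : ℕ, σ ^ j =
      (splitE (m + 1)).permCongr (Equiv.Perm.sumCongr (finRotate (m + 1) ^ j) 1) := by
    intro j
    induction j with
    | zero =>
      ext x
      simp
    | succ j ih =>
      rw [pow_succ, ih, hσe, permCongr_mul', Equiv.Perm.sumCongr_mul, pow_succ, one_mul]
  have hval := perm_pow_val (finRotate (m + 1)) 1 hrot h
  simp only [mul_one] at hval
  rw [Finset.sum_sub_distrib, hpow h]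
  have s1 := sum_P (m + 1) k (finRotate (m + 1) ^ h) (by omega)
  have s2 := sum_P (m + 1) (k - 1) (finRotate (m + 1) ^ h) (by omega)
  rw [← Nat.cast_sum, ← Nat.cast_sum, s1, s2, Nat.sub_add_cancel hk, Finset.sum_range_succ,
    FF_rot (m + 1) h k hn0 _ hval]
  push_cast
  split_ifs <;> ring
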